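/- arXiv:2008.03490 — 3 statements merged into one kernel-verified Lean document; each statement's English description precedes it below -/
import Mathlib

section
/- Let G be a finite group and p a prime such that every normal p-subgroup of G is trivial (O_p(G) = 1). Then every normal p-subgroup of G/Φ(G) is trivial, i.e., O_p(G/Φ(G)) = 1. -/
/-- If `G` is a finite group and `p` is a prime with `O_p(G) = 1`
(every normal `p`-subgroup is trivial), then `O_p(G/Φ(G)) = 1`. -/
theorem op_quotient_frattini_eq_bot
    (G : Type) [Group G] [Finite G] (p : ℕ) (hp : p.Prime)
    (hOp : ∀ Q : Subgroup G, Q.Normal → IsPGroup p Q → Q = ⊥) :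
    ∀ Q : Subgroup (G ⧸ frattini G), Q.Normal → IsPGroup p Q → Q = ⊥ := by
  intro Q hQ hQp
  haveI : Fact p.Prime := ⟨hp⟩
  let π := QuotientGroup.mk' (frattini G)
  have hπ : Function.Surjective π := QuotientGroup.mk'_surjective _
  let N : Subgroup G := Q.comap π
  haveI : N.Normal := hQ.comap π
  let f : N →* Q := π.subgroupComap Q
  have hf : Function.Surjective f := by
    rintro ⟨q, hq⟩
    obtain ⟨g, rfl⟩ := hπ q
    exact ⟨⟨g, hq⟩, rfl⟩
  obtain ⟨P⟩ : Nonempty (Sylow p N) := inferInstance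
  have htop : ((P.mapSurjective hf : Sylow p Q) : Subgroup Q) = ⊤ :=
    ((P.mapSurjective hf).is_maximal' (Q := ⊤) (hQp.to_subgroup ⊤) le_top).symm
  rw [Sylow.coe_mapSurjective] at htop
  have key : ∀ g : G, π g ∈ Q → ∃ x ∈ (P : Subgroup N).map N.subtype, π x = π g := by
    intro g hg
    have : (⟨π g, hg⟩ : Q) ∈ (P : Subgroup N).map f := by rw [htop]; trivial
    obtain ⟨x, hx, hxg⟩ := this
    exact ⟨x, ⟨x, hx, rfl⟩, congrArg Subtype.val hxg⟩
  have hNle : N ≤ Subgroup.normalizer ((P : Subgroup N).map N.subtype : Set G) ⊔ frattini G := by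
    intro g hg
    obtain ⟨x, hx, hxg⟩ := key g hg
    have h1 : x⁻¹ * g ∈ frattini G := QuotientGroup.eq.mp hxg
    have := Subgroup.mul_mem_sup (Subgroup.le_normalizer hx) h1
    simpa using this
  have hsup := P.normalizer_sup_eq_top
  have hnt : Subgroup.normalizer ((P : Subgroup N).map N.subtype : Set G) = ⊤ := by
    apply frattini_nongenerating
    rw [eq_top_iff, ← hsup]
    exact sup_le le_sup_left hNle
  have hb := hOp _ (Subgroup.normalizer_eq_top_iff.mp hnt) (P.isPGroup'.map _)
  rw [eq_bot_iff]
  intro q hq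
  obtain ⟨g, rfl⟩ := hπ q
  obtain ⟨x, hx, hxg⟩ := key g hq
  rw [hb, Subgroup.mem_bot] at hx
  rw [← hxg, hx, map_one]
  exact Subgroup.one_mem _
end

section
/- Let p be an odd prime, and let n and r be positive integers with 2^n − 1 = p^r. Then r is odd and p + 1 is a power of 2; in particular, p is a Mersenne prime. -/
/-- If `p` is an odd prime and `n`, `r` are positive integers with `2^n - 1 = p^r`,
then `r` is odd and `p + 1` is a power of `2`; in particular `p` is a Mersenne prime. -/
theorem odd_and_mersenne_of_two_pow_sub_one_eq_prime_pow
    (p n r : ℕ) (hp : p.Prime) (hodd : Odd p) (hn : 0 < n) (hr : 0 < r)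
    (h : 2 ^ n - 1 = p ^ r) :
    Odd r ∧ ∃ k : ℕ, p + 1 = 2 ^ k := by
  have hpos : 0 < 2 ^ n := by positivity
  have h1 : p ^ r + 1 = 2 ^ n := by omega
  have hgt : 1 < p ^ r := Nat.one_lt_pow hr.ne' hp.one_lt
  have hr' : Odd r := by
    by_contra hne
    rw [Nat.not_odd_iff_even] at hne
    obtain ⟨s, rfl⟩ := hne
    obtain ⟨m, hm⟩ := hodd.pow (n := s)
    have hn2 : 2 ≤ n := by
      by_contra hlt
      have : n = 1 := by omega
      subst this
      omega
    obtain ⟨t, rfl⟩ := Nat.exists_eq_add_of_le hn2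
    have h2 : p ^ (s + s) = 4 * (m * m + m) + 1 := by
      rw [pow_add, hm]; ring
    rw [h2, pow_add] at h1
    omega
  refine ⟨hr', ?_⟩
  have hd : p + 1 ∣ 2 ^ n := by
    have := hr'.nat_add_dvd_pow_add_pow p 1
    rwa [one_pow, h1] at this
  obtain ⟨k, _, hk⟩ := (Nat.dvd_prime_pow Nat.prime_two).1 hd
  exact ⟨k, hk⟩
end

section
/- Let p be an odd prime that is not a Mersenne prime (i.e., p + 1 is not a power of 2), let q be a prime with q ≠ p, let n be a positive integer, and let R be a Sylow p-subgroup of GL(n, F_q). Then R has at least two regular orbits on the natural module F_q^n: there exist vectors v, w ∈ F_q^n lying in distinct R-orbits such that the stabilizer in R of v and the stabilizer in R of w are both trivial. -/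
theorem exists_coloring (p : ℕ) (hp : p.Prime) (hodd : Odd p) {Γ Ω : Type} [Group Γ] [Finite Γ]
    [MulAction Γ Ω] [Finite Ω] : ∀ (k : ℕ) (H : Subgroup Γ) (_ : IsPGroup p H) (B : Set Ω)
    (_ : ∀ h ∈ H, ∀ b ∈ B, h • b ∈ B), B.ncard ≤ k →
    ∃ c : Ω → Bool, ∀ h ∈ H, (∀ b ∈ B, c (h • b) = c b) → ∀ b ∈ B, h • b = b := by
  classical
  have : Fact p.Prime := ⟨hp⟩
  intro k
  induction k with
  | zero =>
    intro H _ B _ hk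
    have : B = ∅ := (Set.ncard_eq_zero).1 (by omega)
    subst this
    exact ⟨fun _ => true, by simp⟩
  | succ k ih =>
    intro H hH B hB hk
    rcases B.eq_empty_or_nonempty with rfl | ⟨ω, hω⟩
    · exact ⟨fun _ => true, by simp⟩
    by_cases hO : ∀ b ∈ B, ∃ h ∈ H, h • ω = b
    swap
    · push Not at hO
      obtain ⟨b₀, hb₀, hb₀'⟩ := hO
      let O : Set Ω := {b | ∃ h ∈ H, h • ω = b}
      have hOB : O ⊆ B := by
        rintro _ ⟨h, hh, rfl⟩
        exact hB h hh _ hω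
      have hOi : ∀ h ∈ H, ∀ b, h • b ∈ O ↔ b ∈ O := by
        intro h hh b
        constructor
        · rintro ⟨g, hg, hgb⟩
          exact ⟨h⁻¹ * g, H.mul_mem (H.inv_mem hh) hg, by rw [mul_smul, hgb, inv_smul_smul]⟩
        · rintro ⟨g, hg, rfl⟩
          exact ⟨h * g, H.mul_mem hh hg, by rw [mul_smul]⟩
      have hω' : ω ∈ O := ⟨1, H.one_mem, one_smul _ _⟩
      have hb₀O : b₀ ∉ O := by
        rintro ⟨h, hh, e⟩
        exact hb₀' h hh e
      have h1 : O.ncard < B.ncard := Set.ncard_lt_ncard ⟨hOB, fun h => hb₀O (h hb₀)⟩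
      have h2 : (B \ O).ncard < B.ncard :=
        Set.ncard_lt_ncard ⟨Set.sdiff_subset, fun h => (h hω).2 hω'⟩
      obtain ⟨c1, hc1⟩ := ih H hH O (fun h hh b hb => (hOi h hh b).2 hb) (by omega)
      obtain ⟨c2, hc2⟩ := ih H hH (B \ O)
        (fun h hh b hb => ⟨hB h hh b hb.1, fun h' => hb.2 ((hOi h hh b).1 h')⟩) (by omega)
      refine ⟨fun b => if b ∈ O then c1 b else c2 b, fun h hh hf b hb => ?_⟩
      by_cases hbO : b ∈ O
      · refine hc1 h hh (fun x hx => ?_) b hbO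
        have := hf x (hOB hx)
        simpa [hOi h hh x, hx] using this
      · refine hc2 h hh (fun x hx => ?_) b ⟨hb, hbO⟩
        have := hf x hx.1
        simpa [hOi h hh x, hx.2] using this
    · rcases eq_top_or_exists_le_coatom (MulAction.stabilizer H ω) with hst | ⟨N', hN', hle⟩
      · refine ⟨fun _ => true, fun h hh _ b hb => ?_⟩
        have key : ∀ g ∈ H, g • ω = ω := by
          intro g hg
          have : (⟨g, hg⟩ : H) ∈ MulAction.stabilizer H ω := by rw [hst]; trivial
          exact this
        obtain ⟨g, hg, rfl⟩ := hO b hb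
        rw [key g hg, key h hh]
      · have : Group.IsNilpotent H := hH.isNilpotent
        have hN'n : N'.Normal :=
          Subgroup.NormalizerCondition.normal_of_coatom N' (Group.normalizerCondition_of_isNilpotent) hN'
        let N : Subgroup Γ := N'.map H.subtype
        have hNmem : ∀ g (hg : g ∈ H), g ∈ N ↔ (⟨g, hg⟩ : H) ∈ N' := by
          intro g hg
          simp [N, hg]
        have hNH : N ≤ H := by
          rintro _ ⟨x, _, rfl⟩
          exact x.2
        have hNconj : ∀ g ∈ H, ∀ n ∈ N, g⁻¹ * n * g ∈ N := by
          intro g hg n hn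
          have hnH := hNH hn
          have h3 := hN'n.conj_mem _ ((hNmem n hnH).1 hn) ⟨g, hg⟩⁻¹
          rw [hNmem _ (H.mul_mem (H.mul_mem (H.inv_mem hg) hnH) hg)]
          rw [inv_inv] at h3
          exact h3
        have hNst : ∀ g ∈ H, g • ω = ω → g ∈ N := by
          intro g hg hgω
          rw [hNmem g hg]
          exact hle hgω
        have hNp : IsPGroup p N := hH.to_le hNH
        obtain ⟨h₀, hh₀, hh₀N⟩ : ∃ h ∈ H, h ∉ N := by
          by_contra hcon
          push Not at hcon
          apply hN'.1
          rw [eq_top_iff]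
          rintro ⟨g, hg⟩ _
          exact (hNmem g hg).1 (hcon g hg)
        let C : Set Ω := {b | ∃ n ∈ N, n • ω = b}
        have hωC : ω ∈ C := ⟨1, N.one_mem, one_smul _ _⟩
        have hCB : C ⊆ B := by
          rintro _ ⟨n, hn, rfl⟩
          exact hB n (hNH hn) _ hω
        have hK : ∀ h ∈ H, ∀ x ∈ C, h • x ∈ C ↔ h ∈ N := by
          rintro h hh _ ⟨n, hn, rfl⟩
          constructor
          · rintro ⟨m, hm, e⟩
            have h4 : m⁻¹ * h * n ∈ N := hNst _
              (H.mul_mem (H.mul_mem (H.inv_mem (hNH hm)) hh) (hNH hn))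
              (by rw [mul_smul, mul_smul, ← e, inv_smul_smul])
            have h5 := N.mul_mem (N.mul_mem hm h4) (N.inv_mem hn)
            simpa [mul_assoc] using h5
          · intro hN
            exact ⟨h * n, N.mul_mem hN hn, by rw [mul_smul]⟩
        have hlt : C.ncard < B.ncard := by
          refine Set.ncard_lt_ncard ⟨hCB, fun h => hh₀N ?_⟩
          exact (hK h₀ hh₀ ω hωC).1 (h (hB h₀ hh₀ ω hω))
        obtain ⟨c, hc⟩ := ih N hNp C (fun n hn x hx => (hK n (hNH hn) x hx).2 hn) (by omega)
        let f : Ω → Bool := fun b => if b ∈ C then c b else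
          !(c ((Classical.epsilon (fun g : Γ => g ∈ H ∧ g⁻¹ • b ∈ C))⁻¹ • b))
        have hf1 : ∀ x ∈ C, f x = c x := by
          intro x hx
          simp [f, hx]
        have hf2 : ∀ g ∈ H, g ∉ N → ∃ n ∈ N, ∀ x ∈ C, f (g • x) = !(c (n • x)) := by
          intro g hg hgN
          let P : Γ → Prop := fun g' => g' ∈ H ∧ g'⁻¹ * g ∈ N
          have hP : P (Classical.epsilon P) :=
            Classical.epsilon_spec (p := P) ⟨g, hg, by simp [N.one_mem]⟩
          refine ⟨(Classical.epsilon P)⁻¹ * g, hP.2, fun x hx => ?_⟩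
          have hx' : g • x ∉ C := fun h => hgN ((hK g hg x hx).1 h)
          have hPe : (fun g' : Γ => g' ∈ H ∧ g'⁻¹ • g • x ∈ C) = P := by
            funext g'
            apply propext
            refine and_congr_right fun hg' => ?_
            rw [← mul_smul]
            exact hK _ (H.mul_mem (H.inv_mem hg') hg) x hx
          simp only [f, hx', if_false, hPe, mul_smul]
        refine ⟨f, fun h hh hfix => ?_⟩
        have hhN : h ∈ N := by
          by_contra hhN
          obtain ⟨n, hn, hnx⟩ := hf2 h hh hhN
          have h6 : ∀ x ∈ C, c (n • x) = !(c x) := by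
            intro x hx
            have := hfix x (hCB hx)
            rw [hnx x hx, hf1 x hx] at this
            rw [← this, Bool.not_not]
          have hnC : ∀ x ∈ C, n • x ∈ C := fun x hx => (hK n (hNH hn) x hx).2 hn
          have h7 : (n ^ 2) • ω = ω := by
            refine hc (n ^ 2) (N.pow_mem hn 2) (fun x hx => ?_) ω hωC
            rw [pow_two, mul_smul, h6 _ (hnC x hx), h6 x hx, Bool.not_not]
          obtain ⟨j, hj⟩ := hNp ⟨n, hn⟩
          have hj' : n ^ (p ^ j) = 1 := by
            have := congrArg Subtype.val hj
            simpa using this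
          obtain ⟨i, hi⟩ : Odd (p ^ j) := hodd.pow
          have h8 : ∀ i : ℕ, (n ^ (2 * i)) • ω = ω := by
            intro i
            induction i with
            | zero => simp
            | succ i ihi => rw [Nat.mul_succ, pow_add, mul_smul, h7, ihi]
          have h9 : n • ω = ω := by
            have e1 : (n ^ (2 * i + 1)) • ω = ω := by rw [← hi, hj', one_smul]
            have e2 : (n * n ^ (2 * i)) • ω = ω := by rw [← pow_succ']; exact e1
            rwa [mul_smul, h8] at e2
          have h10 := h6 ω hωC
          rw [h9] at h10
          cases h : c ω <;> simp [h] at h10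
        intro b hb
        obtain ⟨g, hg, rfl⟩ := hO b hb
        by_cases hgN : g ∈ N
        · refine hc h hhN (fun x hx => ?_) _ ((hK g hg ω hωC).2 hgN)
          have := hfix x (hCB hx)
          rwa [hf1 x hx, hf1 _ ((hK h hh x hx).2 hhN)] at this
        · obtain ⟨n, hn, hnx⟩ := hf2 g hg hgN
          have hm := hNconj g hg h hhN
          set m := g⁻¹ * h * g with hmdef
          have hgm : ∀ x : Ω, g • m • x = h • g • x := by
            intro x
            simp [hmdef, mul_smul]
          have h11 : (n * m * n⁻¹) • (n • ω) = n • ω := by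
            refine hc _ (N.mul_mem (N.mul_mem hn hm) (N.inv_mem hn)) (fun x hx => ?_) _
              ((hK n (hNH hn) ω hωC).2 hn)
            have hy : n⁻¹ • x ∈ C := (hK n⁻¹ (hNH (N.inv_mem hn)) x hx).2 (N.inv_mem hn)
            have e1 := hfix (g • n⁻¹ • x) (hB g hg _ (hCB hy))
            rw [← hgm, hnx _ hy, hnx _ ((hK m (hNH hm) _ hy).2 hm)] at e1
            have e2 := Bool.not_inj e1
            rw [smul_inv_smul] at e2
            rw [mul_smul, mul_smul, e2]
          rw [← hgm]
          rw [mul_smul, inv_smul_smul, mul_smul] at h11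
          rw [smul_left_cancel n h11]

theorem no_prime_power (p : ℕ) (hp : p.Prime) (hodd : Odd p)
    (hM : ¬ ∃ k : ℕ, p + 1 = 2 ^ k) (q : ℕ) (hq : q.Prime) (d a : ℕ) (hd : 0 < d) (ha : 0 < a) :
    q ^ d - 1 ≠ p ^ a := by
  intro h
  have hq1 : 1 ≤ q ^ d := Nat.one_le_pow _ _ hq.pos
  have h1 : q ^ d = p ^ a + 1 := by omega
  have hpo : Odd (p ^ a) := hodd.pow
  have h2 : Even (q ^ d) := by rw [h1]; exact hpo.add_one
  have hq2 : q = 2 := by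
    have : Even q := (Nat.even_pow.1 h2).1
    exact (hq.even_iff).1 this
  subst hq2
  rcases Nat.even_or_odd a with ⟨b, hb⟩ | hao
  · have hb0 : 0 < b := by omega
    have h3 : (p ^ b) % 4 = 1 ∨ (p ^ b) % 4 = 3 := by
      obtain ⟨r, hr⟩ : Odd (p ^ b) := hodd.pow
      omega
    have h4 : p ^ a % 4 = 1 := by
      rw [hb, pow_add, Nat.mul_mod]
      rcases h3 with h | h <;> rw [h]
    have h5 : d < 2 := by
      by_contra hd2
      obtain ⟨e, rfl⟩ : ∃ e, d = 2 + e := ⟨d - 2, by omega⟩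
      rw [pow_add] at h1
      omega
    have h6 : d = 1 := by omega
    subst h6
    have : 1 < p ^ a := Nat.one_lt_pow (by omega) hp.one_lt
    omega
  · have h3 : p + 1 ∣ p ^ a + 1 ^ a := hao.nat_add_dvd_pow_add_pow p 1
    rw [one_pow, ← h1] at h3
    obtain ⟨k, _, hk⟩ := (Nat.dvd_prime_pow Nat.prime_two).1 h3
    exact hM ⟨k, hk⟩

theorem sum_val (p : ℕ) [hp : Fact p.Prime] (hodd : Odd p) (q : ℕ) (hq : q.Prime) (hqp : q ≠ p)
    (d : ℕ) (hd : d = orderOf (q : ZMod p)) (hd0 : 0 < d) (n : ℕ) :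
    ∑ j ∈ Finset.range n, padicValNat p (q ^ (j + 1) - 1) =
      padicValNat p (q ^ d - 1) * (n / d) + padicValNat p (n / d).factorial := by
  have hdvd : ∀ j, p ∣ q ^ j - 1 ↔ d ∣ j := by
    intro j
    have h1 : 1 ≤ q ^ j := Nat.one_le_pow _ _ hq.pos
    rw [hd, orderOf_dvd_iff_pow_eq_one, ← CharP.cast_eq_zero_iff (ZMod p) p, Nat.cast_sub h1,
      sub_eq_zero]
    simp
  have hpq : ¬ p ∣ q := fun h => hqp ((Nat.prime_dvd_prime_iff_eq hp.out hq).1 h).symm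
  induction n with
  | zero => simp
  | succ n ih =>
    rw [Finset.sum_range_succ, ih, Nat.succ_div]
    split_ifs with hdv
    · obtain ⟨k, hk⟩ := hdv
      have hk0 : k ≠ 0 := by rintro rfl; simp at hk
      have hnk : n / d + 1 = k := by
        have : (n + 1) / d = _ := Nat.succ_div
        rw [if_pos ⟨k, hk⟩, hk, Nat.mul_div_cancel_left _ hd0] at this
        exact this.symm
      have h2 : padicValNat p (q ^ (n + 1) - 1) = padicValNat p (q ^ d - 1) + padicValNat p k := by
        have := padicValNat.pow_sub_pow (p := p) (x := q ^ d) (y := 1) hodd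
          (Nat.one_lt_pow hd0.ne' hq.one_lt) ((hdvd d).2 dvd_rfl)
          (fun h => hpq (hp.out.dvd_of_dvd_pow h)) hk0
        rw [one_pow, ← pow_mul, ← hk] at this
        exact this
      rw [h2, Nat.factorial_succ, padicValNat.mul (by omega) (Nat.factorial_ne_zero _), hnk]
      rw [← hnk]
      ring
    · rw [padicValNat.eq_zero_of_not_dvd (fun h => hdv ((hdvd _).1 h))]
      simp

theorem card_GL_val (p : ℕ) [hp : Fact p.Prime] (q : ℕ) [hq : Fact q.Prime] (hqp : q ≠ p) (n : ℕ) :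
    (Nat.card (Matrix.GeneralLinearGroup (Fin n) (ZMod q))).factorization p =
      ∑ j ∈ Finset.range n, padicValNat p (q ^ (j + 1) - 1) := by
  have hpq : ¬ p ∣ q := fun h => hqp ((Nat.prime_dvd_prime_iff_eq hp.out hq.out).1 h).symm
  rw [Matrix.card_GL_field, ZMod.card, Nat.factorization_def _ hp.out]
  rw [Fin.prod_univ_eq_prod_range (fun i => q ^ n - q ^ i) n, ← Finset.prod_range_reflect]
  have hne : ∀ j ∈ Finset.range n, q ^ n - q ^ (n - 1 - j) ≠ 0 := by
    intro j hj
    have : q ^ (n - 1 - j) < q ^ n :=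
      Nat.pow_lt_pow_right hq.out.one_lt (by have := Finset.mem_range.1 hj; omega)
    omega
  rw [← Nat.factorization_def _ hp.out, Nat.factorization_prod hne, Finsupp.finsetSum_apply]
  refine Finset.sum_congr rfl fun j hj => ?_
  have hj' := Finset.mem_range.1 hj
  have e : q ^ n - q ^ (n - 1 - j) = q ^ (n - 1 - j) * (q ^ (j + 1) - 1) := by
    rw [Nat.mul_sub, ← pow_add, mul_one]
    congr 2
    omega
  have hne' : q ^ (j + 1) - 1 ≠ 0 := by
    have := Nat.one_lt_pow (n := j + 1) (by omega) hq.out.one_lt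
    omega
  rw [e, Nat.factorization_def _ hp.out, padicValNat.mul (pow_ne_zero _ hq.out.pos.ne') hne',
    padicValNat.eq_zero_of_not_dvd (fun h => hpq (hp.out.dvd_of_dvd_pow h)), zero_add]

theorem sylow_into (p : ℕ) [hp : Fact p.Prime] {G Q : Type} [Group G] [Group Q] [Finite G]
    [Finite Q] (φ : G →* Q) (hφ : Function.Injective φ)
    (hc : (Nat.card G).factorization p = (Nat.card Q).factorization p) (R : Sylow p Q) :
    ∃ (x : Q) (S : Subgroup G), IsPGroup p S ∧ ∀ g ∈ R, ∃ s ∈ S, x * g * x⁻¹ = φ s := by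
  let S : Sylow p G := default
  have hcard : Nat.card ((S : Subgroup G).map φ) = p ^ (Nat.card Q).factorization p := by
    rw [Subgroup.card_map_of_injective hφ, ← hc]
    exact S.card_eq_multiplicity
  let T : Sylow p Q := Sylow.ofCard _ hcard
  obtain ⟨x, hx⟩ := MulAction.exists_smul_eq Q R T
  refine ⟨x, S, S.2, fun g hg => ?_⟩
  have h1 : x * g * x⁻¹ ∈ x • R := by
    have := Subgroup.smul_mem_pointwise_smul g (MulAut.conj x) (R : Subgroup Q) hg
    simp only [MulAut.smul_def, MulAut.conj_apply] at this
    exact this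
  rw [hx] at h1
  have h2 : x * g * x⁻¹ ∈ (S : Subgroup G).map φ := h1
  obtain ⟨s, hs, e⟩ := h2
  exact ⟨s, hs, e.symm⟩

theorem perm_coloring (p : ℕ) (hp : p.Prime) (hodd : Odd p) (m : ℕ)
    (P : Subgroup (Equiv.Perm (Fin m))) (hP : IsPGroup p P) :
    ∃ c : Fin m → Bool, (∀ σ ∈ P, (∀ i, c (σ i) = c i) → σ = 1) ∧
      (0 < m → ∀ σ ∈ P, ¬ ∀ i, c (σ i) = !(c i)) := by
  obtain ⟨c, hc⟩ := exists_coloring p hp hodd (Γ := Equiv.Perm (Fin m)) (Ω := Fin m) _ P hP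
    Set.univ (by simp) le_rfl
  have h1 : ∀ σ ∈ P, (∀ i, c (σ i) = c i) → σ = 1 := by
    intro σ hσ h
    ext i
    have := hc σ hσ (fun b _ => h b) i trivial
    rw [Equiv.Perm.smul_def] at this
    rw [this]; rfl
  refine ⟨c, h1, fun hm σ hσ h => ?_⟩
  have h2 : σ ^ 2 = 1 := by
    refine h1 _ (P.pow_mem hσ 2) fun i => ?_
    rw [pow_two, Equiv.Perm.mul_apply, h, h, Bool.not_not]
  obtain ⟨j, hj⟩ := hP ⟨σ, hσ⟩
  have hj' : σ ^ (p ^ j) = 1 := by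
    have := congrArg Subtype.val hj
    simpa using this
  obtain ⟨i, hi⟩ : Odd (p ^ j) := hodd.pow
  have h3 : σ = 1 := by
    rw [hi, pow_succ, pow_mul, h2, one_pow, one_mul] at hj'
    exact hj'
  have := h ⟨0, hm⟩
  rw [h3] at this
  cases h' : c ⟨0, hm⟩ <;> simp [h'] at this

abbrev MonoGrp {K : Type} [Field K] (μ : Subgroup Kˣ) (m : ℕ) : Type :=
  (Fin m → μ) ⋊[mulAutArrow (G := Equiv.Perm (Fin m)) (A := Fin m) (M := μ)] Equiv.Perm (Fin m)

def monoLin {F K : Type} [Field F] [Field K] [Algebra F K] (μ : Subgroup Kˣ) (m r : ℕ)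
    (g : MonoGrp μ m) : ((Fin m → K) × (Fin r → F)) →ₗ[F] ((Fin m → K) × (Fin r → F)) where
  toFun x := (fun i => ((g.left i : Kˣ) : K) * x.1 (g.right⁻¹ i), x.2)
  map_add' x y := by
    ext i <;> simp [mul_add]
  map_smul' a x := by
    ext i <;> simp

theorem monoLin_one {F K : Type} [Field F] [Field K] [Algebra F K] (μ : Subgroup Kˣ) (m r : ℕ) :
    monoLin (F := F) μ m r 1 = 1 := by
  apply LinearMap.ext
  intro x
  ext i <;> simp [monoLin]

theorem monoLin_mul {F K : Type} [Field F] [Field K] [Algebra F K] (μ : Subgroup Kˣ) (m r : ℕ)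
    (g h : MonoGrp μ m) :
    monoLin (F := F) μ m r (g * h) = monoLin μ m r g * monoLin μ m r h := by
  apply LinearMap.ext
  intro x
  ext i
  · simp [monoLin, mul_assoc]
    left
    rfl
  · simp [monoLin]

theorem monoLin_inj {F K : Type} [Field F] [Field K] [Algebra F K] (μ : Subgroup Kˣ) (m r : ℕ)
    (g : MonoGrp μ m) (h : monoLin (F := F) μ m r g = 1) : g = 1 := by
  have h1 : ∀ (x : Fin m → K) i, ((g.left i : Kˣ) : K) * x (g.right⁻¹ i) = x i := by
    intro x i
    have := congrArg (fun f => (f (x, 0)).1 i) h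
    simpa [monoLin] using this
  have h2 : g.left = 1 := by
    funext i
    have := h1 (fun _ => 1) i
    simp only [mul_one] at this
    apply Subtype.ext
    apply Units.ext
    simpa using this
  have h3 : g.right = 1 := by
    rw [← inv_eq_one]
    ext i
    have := h1 (fun j => if j = i then 1 else 0) i
    by_contra hne
    have hne' : g.right⁻¹ i ≠ i := fun h => hne (by rw [h]; rfl)
    rw [if_neg hne'] at this
    simp at this
  exact SemidirectProduct.ext h2 h3

theorem mono_orbits (p : ℕ) (hp : p.Prime) (hodd : Odd p) {F K : Type} [Field F] [Field K]
    [Algebra F K] (μ : Subgroup Kˣ) (m r : ℕ) (hmr : 0 < m ∨ 0 < r)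
    (x y : Kˣ) (hxy : x * y⁻¹ ∉ μ) (S : Subgroup (MonoGrp μ m)) (hS : IsPGroup p S) :
    ∃ v w : (Fin m → K) × (Fin r → F),
      (∀ g ∈ S, monoLin μ m r g v = v → g = 1) ∧
      (∀ g ∈ S, monoLin μ m r g w = w → g = 1) ∧
      (∀ g ∈ S, monoLin μ m r g v ≠ w) := by
  have hyx : y * x⁻¹ ∉ μ := fun h => hxy (by have := μ.inv_mem h; simpa using this)
  obtain ⟨c, hc1, hc2⟩ := perm_coloring p hp hodd m (S.map SemidirectProduct.rightHom)
    (hS.map _)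
  let z : Bool → Kˣ := fun b => if b then x else y
  have hz : ∀ (t : μ) a b, (t : Kˣ) * z a = z b → a = b := by
    intro t a b h
    have h' : z b * (z a)⁻¹ ∈ μ := by rw [← h, mul_inv_cancel_right]; exact t.2
    cases a <;> cases b <;> simp_all [z]
  have key : ∀ (g : MonoGrp μ m) (c c' : Fin m → Bool) (u u' : Fin r → F),
      monoLin μ m r g ((fun i => (z (c i) : K)), u) = ((fun i => (z (c' i) : K)), u') →
      (∀ i, c (g.right⁻¹ i) = c' i) ∧ (∀ i, (g.left i : Kˣ) * z (c (g.right⁻¹ i)) = z (c' i))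
        ∧ u = u' := by
    intro g c c' u u' h
    have h1 : ∀ i, (g.left i : Kˣ) * z (c (g.right⁻¹ i)) = z (c' i) := by
      intro i
      apply Units.ext
      have := congrFun (congrArg Prod.fst h) i
      simpa [monoLin] using this
    exact ⟨fun i => hz _ _ _ (h1 i), h1, congrArg Prod.snd h⟩
  have hmem : ∀ g ∈ S, g.right⁻¹ ∈ S.map SemidirectProduct.rightHom := fun g hg =>
    Subgroup.inv_mem _ ⟨g, hg, rfl⟩
  have stab : ∀ (c : Fin m → Bool) (u : Fin r → F),
      (∀ σ ∈ S.map SemidirectProduct.rightHom, (∀ i, c (σ i) = c i) → σ = 1) →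
      ∀ g ∈ S, monoLin μ m r g ((fun i => (z (c i) : K)), u) = ((fun i => (z (c i) : K)), u) →
        g = 1 := by
    intro c u hc g hg h
    obtain ⟨h1, h2, -⟩ := key g c c u u h
    have h3 := hc _ (hmem g hg) h1
    refine SemidirectProduct.ext ?_ (inv_eq_one.1 h3)
    funext i
    have := h2 i
    rw [h1 i] at this
    apply Subtype.ext
    simpa using this
  rcases hmr with hm | hr
  · refine ⟨((fun i => (z (c i) : K)), 0), ((fun i => (z (!(c i)) : K)), 0), stab c 0 hc1, 
      stab (fun i => !(c i)) 0 fun σ hσ h => hc1 σ hσ fun i => Bool.not_inj (h i), ?_⟩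
    intro g hg h
    obtain ⟨h1, -, -⟩ := key g c (fun i => !(c i)) 0 0 h
    exact hc2 hm _ (hmem g hg) h1
  · refine ⟨((fun i => (z (c i) : K)), 0), ((fun i => (z (c i) : K)), fun _ => 1), stab c 0 hc1,
      stab c _ hc1, ?_⟩
    intro g hg h
    obtain ⟨-, -, h1⟩ := key g c c 0 (fun _ => 1) h
    have := congrFun h1 ⟨0, hr⟩
    simp at this

noncomputable def monoGL {F K : Type} [Field F] [Field K] [Algebra F K] (μ : Subgroup Kˣ)
    (m r n : ℕ) (e : (Fin n → F) ≃ₗ[F] ((Fin m → K) × (Fin r → F))) :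
    MonoGrp μ m →* Matrix.GeneralLinearGroup (Fin n) F :=
  MonoidHom.toHomUnits
    { toFun := fun g => LinearMap.toMatrix' (e.symm.toLinearMap ∘ₗ monoLin μ m r g ∘ₗ e.toLinearMap)
      map_one' := by
        rw [monoLin_one]
        have : e.symm.toLinearMap ∘ₗ (1 : Module.End F _) ∘ₗ e.toLinearMap = LinearMap.id := by
          ext; simp
        rw [this, LinearMap.toMatrix'_id]
      map_mul' := fun g h => by
        rw [monoLin_mul, ← LinearMap.toMatrix'_comp]
        congr 1
        apply LinearMap.ext
        intro v
        simp }

theorem monoGL_mulVec {F K : Type} [Field F] [Field K] [Algebra F K] (μ : Subgroup Kˣ)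
    (m r n : ℕ) (e : (Fin n → F) ≃ₗ[F] ((Fin m → K) × (Fin r → F))) (g : MonoGrp μ m)
    (v : Fin n → F) :
    Matrix.mulVec (monoGL μ m r n e g : Matrix (Fin n) (Fin n) F) v
      = e.symm (monoLin μ m r g (e v)) := by
  change Matrix.mulVec (LinearMap.toMatrix'
    (e.symm.toLinearMap ∘ₗ monoLin μ m r g ∘ₗ e.toLinearMap)) v = _
  rw [LinearMap.toMatrix'_mulVec]
  rfl

theorem monoGL_inj {F K : Type} [Field F] [Field K] [Algebra F K] (μ : Subgroup Kˣ)
    (m r n : ℕ) (e : (Fin n → F) ≃ₗ[F] ((Fin m → K) × (Fin r → F))) :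
    Function.Injective (monoGL μ m r n e) := by
  rw [injective_iff_map_eq_one]
  intro g hg
  apply monoLin_inj (F := F) μ m r
  apply LinearMap.ext
  intro x
  have := monoGL_mulVec μ m r n e g (e.symm x)
  rw [hg] at this
  simp only [Units.val_one, Matrix.one_mulVec, LinearEquiv.apply_symm_apply] at this
  exact (e.symm.injective this).symm

/-- Let `p` be an odd prime which is not Mersenne, `q ≠ p` a prime and `R` a Sylow
`p`-subgroup of `GL(n, F_q)`. Then `R` has at least two regular orbits on the natural
module `F_q^n`: there are vectors `v`, `w` in distinct `R`-orbits whose stabilizers in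
`R` are both trivial. -/
theorem sylow_two_regular_orbits_on_natural_module
    (p : ℕ) (hp : p.Prime) (hodd : Odd p) (hnotMersenne : ¬ ∃ k : ℕ, p + 1 = 2 ^ k)
    (q : ℕ) [Fact q.Prime] (hq : q ≠ p) (n : ℕ) (hn : 0 < n)
    (R : Sylow p (Matrix.GeneralLinearGroup (Fin n) (ZMod q))) :
    ∃ v w : Fin n → ZMod q,
      (∀ g ∈ R, Matrix.mulVec (g : Matrix (Fin n) (Fin n) (ZMod q)) v = v → g = 1) ∧
      (∀ g ∈ R, Matrix.mulVec (g : Matrix (Fin n) (Fin n) (ZMod q)) w = w → g = 1) ∧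
      (∀ g ∈ R, Matrix.mulVec (g : Matrix (Fin n) (Fin n) (ZMod q)) v ≠ w) := by
  have hpf : Fact p.Prime := ⟨hp⟩
  have hqp : q.Prime := Fact.out
  have hpq : ¬ p ∣ q := fun h => hq ((Nat.prime_dvd_prime_iff_eq hp hqp).1 h).symm
  obtain ⟨d, hd⟩ : ∃ d, d = orderOf (q : ZMod p) := ⟨_, rfl⟩
  have hqne : (q : ZMod p) ≠ 0 := by
    rw [Ne, CharP.cast_eq_zero_iff (ZMod p) p]; exact hpq
  have hd0 : 0 < d := by
    rw [hd, orderOf_pos_iff, isOfFinOrder_iff_pow_eq_one]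
    exact ⟨p - 1, by have := hp.two_le; omega, ZMod.pow_card_sub_one_eq_one hqne⟩
  have hpd : p ∣ q ^ d - 1 := by
    rw [← CharP.cast_eq_zero_iff (ZMod p) p, Nat.cast_sub (Nat.one_le_pow _ _ hqp.pos), sub_eq_zero,
      hd]
    simpa using pow_orderOf_eq_one (q : ZMod p)
  have hqd1 : 1 < q ^ d := Nat.one_lt_pow hd0.ne' hqp.one_lt
  let K := GaloisField q d
  have : Finite K := inferInstanceAs (Finite (GaloisField q d))
  have hK : Nat.card K = q ^ d := GaloisField.card q d hd0.ne'
  have hKu : Nat.card Kˣ = q ^ d - 1 := by rw [Nat.card_units, hK]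
  let μ : Subgroup Kˣ := ((default : Sylow p Kˣ) : Subgroup Kˣ)
  have hμ : Nat.card μ = p ^ (padicValNat p (q ^ d - 1)) := by
    rw [← Nat.factorization_def _ hp, ← hKu]
    exact (default : Sylow p Kˣ).card_eq_multiplicity
  have ha : 0 < padicValNat p (q ^ d - 1) :=
    one_le_padicValNat_of_dvd (by omega) hpd
  obtain ⟨x, hx⟩ : ∃ x : Kˣ, x ∉ μ := by
    by_contra hcon
    push Not at hcon
    have h1 : μ = ⊤ := by rw [eq_top_iff]; exact fun x _ => hcon x
    rw [h1, Subgroup.card_top, hKu] at hμ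
    exact no_prime_power p hp hodd hnotMersenne q hqp d _ hd0 ha hμ
  have hfr : Module.finrank (ZMod q) (Fin n → ZMod q) =
      Module.finrank (ZMod q) ((Fin (n / d) → K) × (Fin (n % d) → ZMod q)) := by
    rw [Module.finrank_prod, Module.finrank_fin_fun, Module.finrank_fin_fun,
      Module.finrank_pi_fintype, Finset.sum_const, Finset.card_univ, Fintype.card_fin,
      GaloisField.finrank q hd0.ne', smul_eq_mul, mul_comm, Nat.div_add_mod]
  let e := LinearEquiv.ofFinrankEq (R := ZMod q) _ _ hfr
  have hcardG : Nat.card (MonoGrp μ (n / d)) =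
      (p ^ (padicValNat p (q ^ d - 1))) ^ (n / d) * (n / d).factorial := by
    rw [SemidirectProduct.card, Nat.card_fun, hμ, Nat.card_perm]
    simp
  have : Finite (MonoGrp μ (n / d)) := Finite.of_equiv _ SemidirectProduct.equivProd.symm
  have hfac : (Nat.card (MonoGrp μ (n / d))).factorization p =
      (Nat.card (Matrix.GeneralLinearGroup (Fin n) (ZMod q))).factorization p := by
    rw [card_GL_val p q hq n, sum_val p hodd q hqp hq d hd hd0 n, hcardG,
      Nat.factorization_def _ hp, padicValNat.mul (by have := hp.pos; positivity)
        (Nat.factorial_ne_zero _), ← pow_mul, padicValNat.prime_pow]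
  obtain ⟨X, S, hS, hR⟩ := sylow_into p (monoGL μ (n / d) (n % d) n e)
    (monoGL_inj μ (n / d) (n % d) n e) hfac R
  have hmr : 0 < n / d ∨ 0 < n % d := by
    by_contra hcon
    have := Nat.div_add_mod n d
    rw [not_or, Nat.pos_iff_ne_zero, Nat.pos_iff_ne_zero, not_not, not_not] at hcon
    rw [hcon.1, hcon.2] at this
    omega
  obtain ⟨v, w, hv, hw, hvw⟩ := mono_orbits p hp hodd (F := ZMod q) μ (n / d) (n % d) hmr x 1
    (by simpa using hx) S hS
  have tr : ∀ g ∈ R, ∃ s ∈ S, (s = 1 → g = 1) ∧ ∀ a b,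
      Matrix.mulVec (g : Matrix (Fin n) (Fin n) (ZMod q))
        (Matrix.mulVec ((X⁻¹ : Matrix.GeneralLinearGroup (Fin n) (ZMod q)) :
          Matrix (Fin n) (Fin n) (ZMod q)) (e.symm a)) =
        Matrix.mulVec ((X⁻¹ : Matrix.GeneralLinearGroup (Fin n) (ZMod q)) :
          Matrix (Fin n) (Fin n) (ZMod q)) (e.symm b) → monoLin μ (n / d) (n % d) s a = b := by
    intro g hg
    obtain ⟨s, hs, hgs⟩ := hR g hg
    refine ⟨s, hs, ?_, ?_⟩
    · rintro rfl
      rw [map_one, conj_eq_one_iff] at hgs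
      exact hgs
    · intro a b hab
      have h1 := congrArg (Matrix.mulVec (X : Matrix (Fin n) (Fin n) (ZMod q))) hab
      simp only [Matrix.mulVec_mulVec, ← Units.val_mul] at h1
      rw [← mul_assoc, hgs, mul_inv_cancel, monoGL_mulVec] at h1
      simpa using h1
  refine ⟨Matrix.mulVec ((X⁻¹ : Matrix.GeneralLinearGroup (Fin n) (ZMod q)) :
      Matrix (Fin n) (Fin n) (ZMod q)) (e.symm v),
    Matrix.mulVec ((X⁻¹ : Matrix.GeneralLinearGroup (Fin n) (ZMod q)) :
      Matrix (Fin n) (Fin n) (ZMod q)) (e.symm w), ?_, ?_, ?_⟩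
  · intro g hg h
    obtain ⟨s, hs, h1, h2⟩ := tr g hg
    exact h1 (hv s hs (h2 _ _ h))
  · intro g hg h
    obtain ⟨s, hs, h1, h2⟩ := tr g hg
    exact h1 (hw s hs (h2 _ _ h))
  · intro g hg h
    obtain ⟨s, hs, h1, h2⟩ := tr g hg
    exact hvw s hs (h2 _ _ h)
end
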